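/- (Corollary 4.15, focalization) For polarized structures Γ, Δ: the presentation Γ,Δ ⊢ is derivable in LG∅^pol if and only if the focused presentation Π,Σ ⊢ is derivable for every Π ∈ τ*(Γ⁺) and every Σ ∈ τ*(Δ⁺), with the parameter set X instantiated to {Γ⁻, Δ⁻}. -/

import Mathlib

mutual
/-- Positive polarized formulas.  `rsub P N` denotes `P⊘N`, `lsub N P` denotes `N⦸P`. -/
inductive PFm : Type
  | pos : Nat → PFm               -- atom p
  | tens : PFm → PFm → PFm        -- P ⊗ Q
  | rsub : PFm → NFm → PFm        -- P ⊘ N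
  | lsub : NFm → PFm → PFm        -- N ⦸ P
  | disj : PFm → PFm → PFm        -- P ∨ Q
  | down : NFm → PFm              -- ↓N
/-- Negative polarized formulas.  `rdiv M Q` denotes `M/Q`, `ldiv Q M` denotes `Q\M`. -/
inductive NFm : Type
  | neg : Nat → NFm               -- atom p̄
  | par : NFm → NFm → NFm         -- M ⊕ N
  | ldiv : PFm → NFm → NFm        -- Q \ M
  | rdiv : NFm → PFm → NFm        -- M / Q
  | conj : NFm → NFm → NFm        -- M ∧ N
  | up : PFm → NFm                -- ↑P
end

mutual
/-- Polarized linear negation (positive to negative). -/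
def PFm.dual : PFm → NFm
  | .pos n => .neg n
  | .tens P Q => .par Q.dual P.dual        -- (P⊗Q)⊥ = Q⊥⊕P⊥
  | .rsub P N => .ldiv N.dual P.dual       -- (P⊘N)⊥ = N⊥\P⊥
  | .lsub N P => .rdiv P.dual N.dual       -- (N⦸P)⊥ = P⊥/N⊥
  | .disj P Q => .conj Q.dual P.dual       -- (P∨Q)⊥ = Q⊥∧P⊥
  | .down N => .up N.dual                  -- (↓N)⊥ = ↑(N⊥)
/-- Polarized linear negation (negative to positive). -/
def NFm.dual : NFm → PFm
  | .neg n => .pos n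
  | .par M N => .tens N.dual M.dual        -- (M⊕N)⊥ = N⊥⊗M⊥
  | .ldiv Q M => .rsub M.dual Q.dual       -- (Q\M)⊥ = M⊥⊘Q⊥
  | .rdiv M Q => .lsub Q.dual M.dual       -- (M/Q)⊥ = Q⊥⦸M⊥
  | .conj M N => .disj N.dual M.dual       -- (M∧N)⊥ = N⊥∨M⊥
  | .up P => .down P.dual                  -- (↑P)⊥ = ↓(P⊥)
end
/-- Polarized structures, containing only positive formulas.
`slsub Δ Γ` denotes `Δ·⦸·Γ`, `srsub Γ Δ` denotes `Γ·⊘·Δ`. -/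
inductive PStr : Type
  | fm : PFm → PStr
  | stens : PStr → PStr → PStr
  | srsub : PStr → PStr → PStr
  | slsub : PStr → PStr → PStr

mutual
/-- The positive formula interpretation Γ⁺ of a polarized structure. -/
def PStr.posF : PStr → PFm
  | .fm P => P
  | .stens Γ Δ => .tens Γ.posF Δ.posF
  | .srsub Γ Δ => .rsub Γ.posF Δ.negF
  | .slsub Δ Γ => .lsub Δ.negF Γ.posF
/-- The negative formula interpretation Γ⁻ of a polarized structure. -/
def PStr.negF : PStr → NFm
  | .fm P => P.dual
  | .stens Γ Δ => .par Δ.negF Γ.negF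
  | .srsub Γ Δ => .ldiv Δ.posF Γ.negF
  | .slsub Δ Γ => .rdiv Γ.negF Δ.posF
end
mutual
/-- The polarized sequent calculus LG∅^pol: presentation judgement `Γ,Δ ⊢`. -/
inductive PSeq : PStr → PStr → Prop
  | cut {Γ Δ P} : PStoup Δ P → PSeq Γ (.fm P) → PSeq Γ Δ
  | downL {Γ N} : PStoup Γ N.dual → PSeq Γ (.fm (.down N))
  | tensL {Γ P Q} : PSeq Γ (.stens (.fm P) (.fm Q)) → PSeq Γ (.fm (.tens P Q))
  | lsubL {Γ N P} : PSeq Γ (.slsub (.fm N.dual) (.fm P)) → PSeq Γ (.fm (.lsub N P))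
  | rsubL {Γ P N} : PSeq Γ (.srsub (.fm P) (.fm N.dual)) → PSeq Γ (.fm (.rsub P N))
  | disjL {Γ P Q} : PSeq Γ (.fm P) → PSeq Γ (.fm Q) → PSeq Γ (.fm (.disj P Q))
  | sym {Γ Δ} : PSeq Γ Δ → PSeq Δ Γ
  | dp1 {Γ Δ Θ} : PSeq (.stens Γ Δ) Θ → PSeq Γ (.slsub Δ Θ)
  | dp1' {Γ Δ Θ} : PSeq Γ (.slsub Δ Θ) → PSeq (.stens Γ Δ) Θ
  | dp2 {Γ Δ Θ} : PSeq Γ (.stens Δ Θ) → PSeq (.srsub Γ Δ) Θ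
  | dp2' {Γ Δ Θ} : PSeq (.srsub Γ Δ) Θ → PSeq Γ (.stens Δ Θ)
/-- The polarized sequent calculus LG∅^pol: stoup judgement `Γ ⊢ P`. -/
inductive PStoup : PStr → PFm → Prop
  | id {P} : PStoup (.fm P) P
  | downR {Γ N} : PSeq Γ (.fm N.dual) → PStoup Γ (.down N)
  | tensR {Γ Δ P Q} : PStoup Γ P → PStoup Δ Q → PStoup (.stens Γ Δ) (.tens P Q)
  | lsubR {Γ Δ N P} : PStoup Δ N.dual → PStoup Γ P → PStoup (.slsub Δ Γ) (.lsub N P)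
  | rsubR {Γ Δ N P} : PStoup Δ N.dual → PStoup Γ P → PStoup (.srsub Γ Δ) (.rsub P N)
  | disjRl {Γ P Q} : PStoup Γ P → PStoup Γ (.disj P Q)
  | disjRr {Γ P Q} : PStoup Γ Q → PStoup Γ (.disj P Q)
end
/-- A polarized formula: either positive or negative. -/
abbrev Pol : Type := PFm ⊕ NFm

mutual
/-- The subformula map σ on negative polarized formulas. -/
def ssig : NFm → Set Pol
  | .up P => insert (Sum.inr P.dual) (ttau P)       -- σ(↑P) = {P⊥} ∪ τ(P)
  | .neg n => {Sum.inr (.neg n)}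
  | .conj M N => ssig M ∪ ssig N
  | .par M N => ssig M ∪ ssig N
  | .rdiv M Q => ssig M ∪ ttau Q
  | .ldiv Q M => ssig M ∪ ttau Q
/-- The subformula map τ on positive polarized formulas. -/
def ttau : PFm → Set Pol
  | .down N => insert (Sum.inr N) (ssig N)          -- τ(↓N) = {N} ∪ σ(N)
  | .pos n => {Sum.inl (.pos n)}
  | .disj P Q => ttau P ∪ ttau Q
  | .tens P Q => ttau P ∪ ttau Q
  | .lsub N P => ttau P ∪ ssig N
  | .rsub P N => ttau P ∪ ssig N
end

/-- The closure X^τ = ⋃ { τ(↓N) | N ∈ X } of a set X of negative formulas. -/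
def Xtau (X : Set NFm) : Set Pol := {a | ∃ N ∈ X, a ∈ ttau (.down N)}
/-- Focused structures: π ::= p | N | π·⊗·σ | π·⊘·σ | σ·⦸·π, where a negative formula `N`
stands for its implicit ↓-shift.  `slsub σ π` denotes `σ·⦸·π`, `srsub π σ` denotes `π·⊘·σ`. -/
inductive FStr : Type
  | at : Nat → FStr
  | nfm : NFm → FStr
  | stens : FStr → FStr → FStr
  | srsub : FStr → FStr → FStr
  | slsub : FStr → FStr → FStr

/-- The decomposition relation `Tstar P σ`, i.e. `σ ∈ τ*(P)`:
τ*(P⊗Q)={π·⊗·σ | π∈τ*(P), σ∈τ*(Q)}, τ*(P⊘N)={π·⊘·σ | π∈τ*(P), σ∈τ*(N⊥)},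
τ*(N⦸P)={σ·⦸·π | π∈τ*(P), σ∈τ*(N⊥)}, τ*(P∨Q)=τ*(P)∪τ*(Q), τ*(p)={p}, τ*(↓N)={N}. -/
inductive Tstar : PFm → FStr → Prop
  | tens {P Q π σ} : Tstar P π → Tstar Q σ → Tstar (.tens P Q) (.stens π σ)
  | rsub {P N π σ} : Tstar P π → Tstar N.dual σ → Tstar (.rsub P N) (.srsub π σ)
  | lsub {N P π σ} : Tstar P π → Tstar N.dual σ → Tstar (.lsub N P) (.slsub σ π)
  | disjl {P Q π} : Tstar P π → Tstar (.disj P Q) π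
  | disjr {P Q π} : Tstar Q π → Tstar (.disj P Q) π
  | at {n} : Tstar (.pos n) (.at n)
  | down {N} : Tstar (.down N) (.nfm N)
/-- One-hole contexts over focused structures. -/
inductive FCtx : Type
  | hole : FCtx
  | tensL : FCtx → FStr → FCtx      -- π[]·⊗·σ
  | tensR : FStr → FCtx → FCtx      -- π·⊗·σ[]
  | rsubL : FCtx → FStr → FCtx      -- π[]·⊘·σ
  | rsubR : FStr → FCtx → FCtx      -- π·⊘·σ[]
  | lsubL : FCtx → FStr → FCtx      -- σ[]·⦸·π
  | lsubR : FStr → FCtx → FCtx      -- σ·⦸·π[]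

/-- Substitution `π[υ]` of a structure for the hole of a context. -/
def FCtx.fill : FCtx → FStr → FStr
  | .hole, υ => υ
  | .tensL c σ, υ => .stens (c.fill υ) σ
  | .tensR π c, υ => .stens π (c.fill υ)
  | .rsubL c σ, υ => .srsub (c.fill υ) σ
  | .rsubR π c, υ => .srsub π (c.fill υ)
  | .lsubL c π, υ => .slsub (c.fill υ) π
  | .lsubR σ c, υ => .slsub σ (c.fill υ)

/-- The display map `π[] ÷ υ`. -/
def FCtx.div : FCtx → FStr → FStr
  | .hole, υ => υ
  | .tensL c σ, υ => c.div (.slsub σ υ)       -- (π[]·⊗·σ)÷υ = π[]÷(σ·⦸·υ)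
  | .tensR π c, υ => c.div (.srsub υ π)       -- (π·⊗·σ[])÷υ = σ[]÷(υ·⊘·π)
  | .rsubL c σ, υ => c.div (.stens σ υ)       -- (π[]·⊘·σ)÷υ = π[]÷(σ·⊗·υ)
  | .rsubR π c, υ => c.div (.slsub υ π)       -- (π·⊘·σ[])÷υ = σ[]÷(υ·⦸·π)
  | .lsubR σ c, υ => c.div (.stens υ σ)       -- (σ·⦸·π[])÷υ = π[]÷(υ·⊗·σ)
  | .lsubL c π, υ => c.div (.srsub π υ)       -- (σ[]·⦸·π)÷υ = σ[]÷(π·⊘·υ)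
mutual
/-- Strongly focused derivability of presentations `π,σ ⊢`, relative to the parameter
set `X` of negative formulas.  The rule (D) covers both presentation contexts
`ω[] = ⟨π[],σ⟩` and `ω[] = ⟨σ,π[]⟩`, with `ω*[] = π[]÷σ`. -/
inductive FSeq (X : Set NFm) : FStr → FStr → Prop
  | decL {N σ'} (c : FCtx) (υ : FStr) : Sum.inr N ∈ Xtau X → Tstar N.dual σ' →
      FFoc X (c.div υ) σ' → FSeq X (c.fill (.nfm N)) υ
  | decR {N σ'} (c : FCtx) (υ : FStr) : Sum.inr N ∈ Xtau X → Tstar N.dual σ' →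
      FFoc X (c.div υ) σ' → FSeq X υ (c.fill (.nfm N))
/-- Strongly focused derivability `π ⊢f σ` (context splitting judgement). -/
inductive FFoc (X : Set NFm) : FStr → FStr → Prop
  | id {n} : FFoc X (.at n) (.at n)
  | react {π N} : (∀ σ, Tstar N.dual σ → FSeq X π σ) → FFoc X π (.nfm N)
  | tens {π π' σ σ'} : FFoc X π π' → FFoc X σ σ' → FFoc X (.stens π σ) (.stens π' σ')
  | rsub {π π' σ σ'} : FFoc X σ σ' → FFoc X π π' → FFoc X (.srsub π σ) (.srsub π' σ')
  | lsub {π π' σ σ'} : FFoc X σ σ' → FFoc X π π' → FFoc X (.slsub σ π) (.slsub σ' π')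
end

mutual
theorem PFm.dd : ∀ P : PFm, P.dual.dual = P
  | .pos n => by simp [PFm.dual, NFm.dual]
  | .tens P Q => by simp [PFm.dual, NFm.dual, PFm.dd P, PFm.dd Q]
  | .rsub P N => by simp [PFm.dual, NFm.dual, PFm.dd P, NFm.dd N]
  | .lsub N P => by simp [PFm.dual, NFm.dual, PFm.dd P, NFm.dd N]
  | .disj P Q => by simp [PFm.dual, NFm.dual, PFm.dd P, PFm.dd Q]
  | .down N => by simp [PFm.dual, NFm.dual, NFm.dd N]
theorem NFm.dd : ∀ N : NFm, N.dual.dual = N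
  | .neg n => by simp [PFm.dual, NFm.dual]
  | .par P Q => by simp [PFm.dual, NFm.dual, NFm.dd P, NFm.dd Q]
  | .ldiv P N => by simp [PFm.dual, NFm.dual, PFm.dd P, NFm.dd N]
  | .rdiv N P => by simp [PFm.dual, NFm.dual, PFm.dd P, NFm.dd N]
  | .conj P Q => by simp [PFm.dual, NFm.dual, NFm.dd P, NFm.dd Q]
  | .up N => by simp [PFm.dual, NFm.dual, PFm.dd N]
end

mutual
def PFm.sz : PFm → ℕ
  | .pos _ => 1
  | .tens P Q => P.sz + Q.sz + 1
  | .rsub P N => P.sz + N.sz + 1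
  | .lsub N P => N.sz + P.sz + 1
  | .disj P Q => P.sz + Q.sz + 1
  | .down N => N.sz + 1
def NFm.sz : NFm → ℕ
  | .neg _ => 1
  | .par P Q => P.sz + Q.sz + 1
  | .ldiv P N => P.sz + N.sz + 1
  | .rdiv N P => N.sz + P.sz + 1
  | .conj P Q => P.sz + Q.sz + 1
  | .up N => N.sz + 1
end

mutual
theorem PFm.sz_dual : ∀ P : PFm, P.dual.sz = P.sz
  | .pos n => by simp [PFm.dual, PFm.sz, NFm.sz]
  | .tens P Q => by simp [PFm.dual, PFm.sz, NFm.sz, PFm.sz_dual P, PFm.sz_dual Q, add_comm]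
  | .rsub P N => by simp [PFm.dual, PFm.sz, NFm.sz, PFm.sz_dual P, NFm.sz_dual N, add_comm]
  | .lsub N P => by simp [PFm.dual, PFm.sz, NFm.sz, PFm.sz_dual P, NFm.sz_dual N, add_comm]
  | .disj P Q => by simp [PFm.dual, PFm.sz, NFm.sz, PFm.sz_dual P, PFm.sz_dual Q, add_comm]
  | .down N => by simp [PFm.dual, PFm.sz, NFm.sz, NFm.sz_dual N]
theorem NFm.sz_dual : ∀ N : NFm, N.dual.sz = N.sz
  | .neg n => by simp [NFm.dual, PFm.sz, NFm.sz]
  | .par P Q => by simp [NFm.dual, PFm.sz, NFm.sz, NFm.sz_dual P, NFm.sz_dual Q, add_comm]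
  | .ldiv P N => by simp [NFm.dual, PFm.sz, NFm.sz, PFm.sz_dual P, NFm.sz_dual N, add_comm]
  | .rdiv N P => by simp [NFm.dual, PFm.sz, NFm.sz, PFm.sz_dual P, NFm.sz_dual N, add_comm]
  | .conj P Q => by simp [NFm.dual, PFm.sz, NFm.sz, NFm.sz_dual P, NFm.sz_dual Q, add_comm]
  | .up N => by simp [NFm.dual, PFm.sz, NFm.sz, PFm.sz_dual N]
end

theorem PStr.neg_dual (Γ : PStr) : Γ.negF.dual = Γ.posF := by
  have h : ∀ Γ : PStr, Γ.negF = Γ.posF.dual := by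
    intro Γ
    induction Γ with
    | fm P => simp [PStr.negF, PStr.posF]
    | stens a b iha ihb => simp [PStr.negF, PStr.posF, PFm.dual, iha, ihb]
    | srsub a b iha ihb => simp [PStr.negF, PStr.posF, PFm.dual, iha, ihb, PFm.dd]
    | slsub a b iha ihb => simp [PStr.negF, PStr.posF, PFm.dual, iha, ihb, PFm.dd]
  rw [h, PFm.dd]

/-- all negative leaves satisfy `K` -/
def FStr.All (K : NFm → Prop) : FStr → Prop
  | .at _ => True
  | .nfm N => K N
  | .stens a b => a.All K ∧ b.All K
  | .srsub a b => a.All K ∧ b.All K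
  | .slsub a b => a.All K ∧ b.All K

theorem FCtx.all_fill {K : NFm → Prop} {N : NFm} : ∀ (c : FCtx) (u : FStr),
    (c.fill (.nfm N)).All K → u.All K → K N ∧ (c.div u).All K := by
  intro c
  induction c with
  | hole => exact fun u h hu => ⟨h, hu⟩
  | tensL c s ih => exact fun u h hu => ih _ h.1 ⟨h.2, hu⟩
  | tensR s c ih => exact fun u h hu => ih _ h.2 ⟨hu, h.1⟩
  | rsubL c s ih => exact fun u h hu => ih _ h.1 ⟨h.2, hu⟩
  | rsubR s c ih => exact fun u h hu => ih _ h.2 ⟨hu, h.1⟩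
  | lsubL c s ih => exact fun u h hu => ih _ h.1 ⟨h.2, hu⟩
  | lsubR s c ih => exact fun u h hu => ih _ h.2 ⟨hu, h.1⟩

theorem FStr.All.mono {K L : NFm → Prop} (h : ∀ N, K N → L N) : ∀ s : FStr, s.All K → s.All L
  | .at _ => fun _ => trivial
  | .nfm N => h N
  | .stens a b => fun k => ⟨FStr.All.mono h a k.1, FStr.All.mono h b k.2⟩
  | .srsub a b => fun k => ⟨FStr.All.mono h a k.1, FStr.All.mono h b k.2⟩
  | .slsub a b => fun k => ⟨FStr.All.mono h a k.1, FStr.All.mono h b k.2⟩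

theorem Tstar.all_sz {P s} (h : Tstar P s) : s.All (fun N => N.sz < P.sz) := by
  induction h with
  | tens _ _ i j =>
    exact ⟨i.mono (fun _ h => by simp only [PFm.sz]; omega), j.mono (fun _ h => by simp only [PFm.sz]; omega)⟩
  | rsub _ _ i j =>
    simp only [NFm.sz_dual] at j
    exact ⟨i.mono (fun _ h => by simp only [PFm.sz]; omega), j.mono (fun _ h => by simp only [PFm.sz]; omega)⟩
  | lsub _ _ i j =>
    simp only [NFm.sz_dual] at j
    exact ⟨j.mono (fun _ h => by simp only [PFm.sz]; omega), i.mono (fun _ h => by simp only [PFm.sz]; omega)⟩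
  | disjl _ i => exact i.mono (fun _ h => by simp only [PFm.sz]; omega)
  | disjr _ i => exact i.mono (fun _ h => by simp only [PFm.sz]; omega)
  | down => simp [FStr.All, PFm.sz]
  | _ => trivial

/-! Clean subformula sets -/
mutual
def PFm.E : PFm → Set NFm
  | .pos _ => ∅
  | .tens P Q => P.E ∪ Q.E
  | .rsub P N => P.E ∪ N.E
  | .lsub N P => P.E ∪ N.E
  | .disj P Q => P.E ∪ Q.E
  | .down N => insert N N.E
def NFm.E : NFm → Set NFm
  | .neg _ => ∅
  | .par P Q => P.E ∪ Q.E
  | .ldiv P N => N.E ∪ P.E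
  | .rdiv N P => N.E ∪ P.E
  | .conj P Q => P.E ∪ Q.E
  | .up P => insert P.dual P.E
end

mutual
theorem PFm.E_dual : ∀ P : PFm, P.dual.E = P.E
  | .pos n => by simp [PFm.dual, PFm.E, NFm.E]
  | .tens P Q => by simp [PFm.dual, PFm.E, NFm.E, PFm.E_dual P, PFm.E_dual Q, Set.union_comm]
  | .rsub P N => by simp [PFm.dual, PFm.E, NFm.E, PFm.E_dual P, NFm.E_dual N]
  | .lsub N P => by simp [PFm.dual, PFm.E, NFm.E, PFm.E_dual P, NFm.E_dual N]
  | .disj P Q => by simp [PFm.dual, PFm.E, NFm.E, PFm.E_dual P, PFm.E_dual Q, Set.union_comm]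
  | .down N => by simp [PFm.dual, PFm.E, NFm.E, NFm.E_dual N, NFm.dd]
theorem NFm.E_dual : ∀ N : NFm, N.dual.E = N.E
  | .neg n => by simp [NFm.dual, PFm.E, NFm.E]
  | .par P Q => by simp [NFm.dual, PFm.E, NFm.E, NFm.E_dual P, NFm.E_dual Q, Set.union_comm]
  | .ldiv P N => by simp [NFm.dual, PFm.E, NFm.E, PFm.E_dual P, NFm.E_dual N]
  | .rdiv N P => by simp [NFm.dual, PFm.E, NFm.E, PFm.E_dual P, NFm.E_dual N]
  | .conj P Q => by simp [NFm.dual, PFm.E, NFm.E, NFm.E_dual P, NFm.E_dual Q, Set.union_comm]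
  | .up P => by simp [NFm.dual, PFm.E, NFm.E, PFm.E_dual P]
end

mutual
theorem PFm.E_trans (M : NFm) : ∀ P : PFm, M ∈ P.E → M.E ⊆ P.E
  | .pos n => by simp [PFm.E]
  | .tens P Q => by
    simp only [PFm.E]; rintro (h | h)
    · exact (PFm.E_trans M P h).trans Set.subset_union_left
    · exact (PFm.E_trans M Q h).trans Set.subset_union_right
  | .disj P Q => by
    simp only [PFm.E]; rintro (h | h)
    · exact (PFm.E_trans M P h).trans Set.subset_union_left
    · exact (PFm.E_trans M Q h).trans Set.subset_union_right
  | .rsub P N => by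
    simp only [PFm.E]; rintro (h | h)
    · exact (PFm.E_trans M P h).trans Set.subset_union_left
    · exact (NFm.E_trans M N h).trans Set.subset_union_right
  | .lsub N P => by
    simp only [PFm.E]; rintro (h | h)
    · exact (PFm.E_trans M P h).trans Set.subset_union_left
    · exact (NFm.E_trans M N h).trans Set.subset_union_right
  | .down N => by
    simp only [PFm.E]; rintro (h | h)
    · subst h; exact Set.subset_insert _ _
    · exact (NFm.E_trans M N h).trans (Set.subset_insert _ _)
theorem NFm.E_trans (M : NFm) : ∀ N : NFm, M ∈ N.E → M.E ⊆ N.E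
  | .neg n => by simp [NFm.E]
  | .par P Q => by
    simp only [NFm.E]; rintro (h | h)
    · exact (NFm.E_trans M P h).trans Set.subset_union_left
    · exact (NFm.E_trans M Q h).trans Set.subset_union_right
  | .conj P Q => by
    simp only [NFm.E]; rintro (h | h)
    · exact (NFm.E_trans M P h).trans Set.subset_union_left
    · exact (NFm.E_trans M Q h).trans Set.subset_union_right
  | .ldiv P N => by
    simp only [NFm.E]; rintro (h | h)
    · exact (NFm.E_trans M N h).trans Set.subset_union_left
    · exact (PFm.E_trans M P h).trans Set.subset_union_right
  | .rdiv N P => by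
    simp only [NFm.E]; rintro (h | h)
    · exact (NFm.E_trans M N h).trans Set.subset_union_left
    · exact (PFm.E_trans M P h).trans Set.subset_union_right
  | .up P => by
    simp only [NFm.E]; rintro (h | h)
    · subst h; rw [PFm.E_dual]; exact Set.subset_insert _ _
    · exact (PFm.E_trans M P h).trans (Set.subset_insert _ _)
end

mutual
theorem PFm.E_tau (M : NFm) : ∀ P : PFm, (M ∈ P.E → Sum.inr M ∈ ttau P) ∧
    (Sum.inr M ∈ ttau P → M ∈ P.E ∨ M.E = ∅)
  | .pos n => by simp [PFm.E, ttau]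
  | .tens P Q => by
    have := PFm.E_tau M P; have := PFm.E_tau M Q; simp only [PFm.E, ttau, Set.mem_union]; tauto
  | .disj P Q => by
    have := PFm.E_tau M P; have := PFm.E_tau M Q; simp only [PFm.E, ttau, Set.mem_union]; tauto
  | .rsub P N => by
    have := PFm.E_tau M P; have := NFm.E_sig M N; simp only [PFm.E, ttau, Set.mem_union]; tauto
  | .lsub N P => by
    have := PFm.E_tau M P; have := NFm.E_sig M N; simp only [PFm.E, ttau, Set.mem_union]; tauto
  | .down N => by
    have := NFm.E_sig M N
    simp only [PFm.E, ttau, Set.mem_insert_iff, Sum.inr.injEq]; tauto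
theorem NFm.E_sig (M : NFm) : ∀ N : NFm, (M ∈ N.E → Sum.inr M ∈ ssig N) ∧
    (Sum.inr M ∈ ssig N → M ∈ N.E ∨ M.E = ∅)
  | .neg n => by
    simp only [NFm.E, ssig, Set.mem_singleton_iff, Sum.inr.injEq]
    exact ⟨fun h => h.elim, fun h => by subst h; simp [NFm.E]⟩
  | .par P Q => by
    have := NFm.E_sig M P; have := NFm.E_sig M Q; simp only [NFm.E, ssig, Set.mem_union]; tauto
  | .conj P Q => by
    have := NFm.E_sig M P; have := NFm.E_sig M Q; simp only [NFm.E, ssig, Set.mem_union]; tauto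
  | .ldiv P N => by
    have := PFm.E_tau M P; have := NFm.E_sig M N; simp only [NFm.E, ssig, Set.mem_union]; tauto
  | .rdiv N P => by
    have := PFm.E_tau M P; have := NFm.E_sig M N; simp only [NFm.E, ssig, Set.mem_union]; tauto
  | .up P => by
    have := PFm.E_tau M P
    simp only [NFm.E, ssig, Set.mem_insert_iff, Sum.inr.injEq]; tauto
end

theorem Tstar.all_E {P s} (h : Tstar P s) : s.All (fun N => N ∈ P.E) := by
  induction h with
  | tens _ _ i j =>
    exact ⟨i.mono (fun _ h => Or.inl h), j.mono (fun _ h => Or.inr h)⟩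
  | rsub _ _ i j =>
    simp only [NFm.E_dual] at j
    exact ⟨i.mono (fun _ h => Or.inl h), j.mono (fun _ h => Or.inr h)⟩
  | lsub _ _ i j =>
    simp only [NFm.E_dual] at j
    exact ⟨j.mono (fun _ h => Or.inr h), i.mono (fun _ h => Or.inl h)⟩
  | disjl _ i => exact i.mono (fun _ h => Or.inl h)
  | disjr _ i => exact i.mono (fun _ h => Or.inr h)
  | down => simp [FStr.All, PFm.E]
  | _ => trivial

theorem xtau_closed {X : Set NFm} {N : NFm} (h : Sum.inr N ∈ Xtau X) {s} (hs : Tstar N.dual s) :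
    s.All (fun M => Sum.inr M ∈ Xtau X) := by
  refine hs.all_E.mono ?_
  intro M hM
  rw [NFm.E_dual] at hM
  obtain ⟨K, hK, h⟩ := h
  refine ⟨K, hK, (PFm.E_tau M _).1 ?_⟩
  rcases (PFm.E_tau N _).2 h with h | h
  · exact PFm.E_trans N _ h hM
  · rw [h] at hM; exact hM.elim

theorem mem_univ_xtau (N : NFm) : Sum.inr N ∈ Xtau Set.univ :=
  ⟨N, trivial, by simp [ttau]⟩

theorem mem_xtau {X : Set NFm} {N : NFm} (h : N ∈ X) : Sum.inr N ∈ Xtau X :=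
  ⟨N, h, by simp [ttau]⟩

mutual
theorem FSeq.restrict {X : Set NFm} : ∀ {a b}, FSeq Set.univ a b →
    a.All (fun M => Sum.inr M ∈ Xtau X) → b.All (fun M => Sum.inr M ∈ Xtau X) → FSeq X a b
  | _, _, .decL c _ _ ht hf => fun ha hb =>
    have k := c.all_fill _ ha hb
    .decL c _ k.1 ht (hf.restrict k.2 (xtau_closed k.1 ht))
  | _, _, .decR c _ _ ht hf => fun hb ha =>
    have k := c.all_fill _ ha hb
    .decR c _ k.1 ht (hf.restrict k.2 (xtau_closed k.1 ht))
theorem FFoc.restrict {X : Set NFm} : ∀ {a b}, FFoc Set.univ a b →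
    a.All (fun M => Sum.inr M ∈ Xtau X) → b.All (fun M => Sum.inr M ∈ Xtau X) → FFoc X a b
  | _, _, .id => fun _ _ => .id
  | _, _, .react h => fun ha hb => .react fun s hs => (h s hs).restrict ha (xtau_closed hb hs)
  | _, _, .tens h k => fun ha hb => .tens (h.restrict ha.1 hb.1) (k.restrict ha.2 hb.2)
  | _, _, .rsub h k => fun ha hb => .rsub (h.restrict ha.2 hb.2) (k.restrict ha.1 hb.1)
  | _, _, .lsub h k => fun ha hb => .lsub (h.restrict ha.1 hb.1) (k.restrict ha.2 hb.2)
end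

/-! Display postulates for the unrestricted focused calculus -/
theorem FSeq.sym {X a b} (h : FSeq X a b) : FSeq X b a := by
  cases h with
  | decL c u h1 h2 h3 => exact .decR c _ h1 h2 h3
  | decR c u h1 h2 h3 => exact .decL c _ h1 h2 h3

theorem FSeq.dp1 {X a b d} (h : FSeq X (.stens a b) d) : FSeq X a (.slsub b d) := by
  generalize e : FStr.stens a b = x at h
  cases h with
  | decL c u h1 h2 h3 =>
    cases c <;> simp only [FCtx.fill, reduceCtorEq, FStr.stens.injEq] at e
    · obtain ⟨rfl, rfl⟩ := e; exact .decL _ _ h1 h2 h3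
    · obtain ⟨rfl, rfl⟩ := e; exact .decR (.lsubL _ _) _ h1 h2 h3
  | decR c u h1 h2 h3 => subst e; exact .decR (.lsubR _ _) _ h1 h2 h3

theorem FSeq.dp1' {X a b d} (h : FSeq X a (.slsub b d)) : FSeq X (.stens a b) d := by
  generalize e : FStr.slsub b d = x at h
  cases h with
  | decR c u h1 h2 h3 =>
    cases c <;> simp only [FCtx.fill, reduceCtorEq, FStr.slsub.injEq] at e
    · obtain ⟨rfl, rfl⟩ := e; exact .decL (.tensR _ _) _ h1 h2 h3
    · obtain ⟨rfl, rfl⟩ := e; exact .decR _ _ h1 h2 h3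
  | decL c u h1 h2 h3 => subst e; exact .decL (.tensL _ _) _ h1 h2 h3

theorem FSeq.dp2 {X a b d} (h : FSeq X a (.stens b d)) : FSeq X (.srsub a b) d := by
  generalize e : FStr.stens b d = x at h
  cases h with
  | decR c u h1 h2 h3 =>
    cases c <;> simp only [FCtx.fill, reduceCtorEq, FStr.stens.injEq] at e
    · obtain ⟨rfl, rfl⟩ := e; exact .decL (.rsubR _ _) _ h1 h2 h3
    · obtain ⟨rfl, rfl⟩ := e; exact .decR _ _ h1 h2 h3
  | decL c u h1 h2 h3 => subst e; exact .decL (.rsubL _ _) _ h1 h2 h3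

theorem FSeq.dp2' {X a b d} (h : FSeq X (.srsub a b) d) : FSeq X a (.stens b d) := by
  generalize e : FStr.srsub a b = x at h
  cases h with
  | decL c u h1 h2 h3 =>
    cases c <;> simp only [FCtx.fill, reduceCtorEq, FStr.srsub.injEq] at e
    · obtain ⟨rfl, rfl⟩ := e; exact .decL _ _ h1 h2 h3
    · obtain ⟨rfl, rfl⟩ := e; exact .decR (.tensL _ _) _ h1 h2 h3
  | decR c u h1 h2 h3 => subst e; exact .decR (.tensR _ _) _ h1 h2 h3

theorem FSeq.undisplay {X a} : ∀ (c : FCtx) (u : FStr), FSeq X a (c.div u) → FSeq X (c.fill a) u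
  | .hole, _, h => h
  | .tensL c _, _, h => (FSeq.undisplay c _ h).dp1'
  | .tensR _ c, _, h => (FSeq.undisplay c _ h).sym.dp2'.sym
  | .rsubL c _, _, h => (FSeq.undisplay c _ h).dp2
  | .rsubR _ c, _, h => (FSeq.undisplay c _ h).dp1'.sym.dp2
  | .lsubR _ c, _, h => (FSeq.undisplay c _ h).sym.dp1.sym
  | .lsubL c _, _, h => (FSeq.undisplay c _ h).sym.dp2'.sym.dp1.sym

/-- `SRep N p a b`: `b` arises from `a` by replacing some leaves `N` by `p`. -/
inductive SRep (N : NFm) (p : FStr) : FStr → FStr → Prop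
  | rep : SRep N p (.nfm N) p
  | atm (n) : SRep N p (.at n) (.at n)
  | nfm (M) : SRep N p (.nfm M) (.nfm M)
  | stens {a b a' b'} : SRep N p a a' → SRep N p b b' → SRep N p (.stens a b) (.stens a' b')
  | srsub {a b a' b'} : SRep N p a a' → SRep N p b b' → SRep N p (.srsub a b) (.srsub a' b')
  | slsub {a b a' b'} : SRep N p a a' → SRep N p b b' → SRep N p (.slsub a b) (.slsub a' b')

theorem SRep.rfl' {N p} : ∀ a, SRep N p a a
  | .at n => .atm n
  | .nfm M => .nfm M
  | .stens a b => .stens (SRep.rfl' a) (SRep.rfl' b)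
  | .srsub a b => .srsub (SRep.rfl' a) (SRep.rfl' b)
  | .slsub a b => .slsub (SRep.rfl' a) (SRep.rfl' b)

theorem SRep.ctx {N p M} : ∀ (c : FCtx) {b}, SRep N p (c.fill (.nfm M)) b →
    ∃ (c' : FCtx) (x : FStr), b = c'.fill x ∧ SRep N p (.nfm M) x ∧
      ∀ u u', SRep N p u u' → SRep N p (c.div u) (c'.div u')
  | .hole, b, h => ⟨.hole, b, rfl, h, fun _ _ h => h⟩
  | .tensL c s, b, h => by
    cases h with
    | stens h1 h2 =>
      obtain ⟨c', x, rfl, hx, hd⟩ := SRep.ctx c h1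
      exact ⟨.tensL c' _, x, rfl, hx, fun u u' hu => hd _ _ (.slsub h2 hu)⟩
  | .tensR s c, b, h => by
    cases h with
    | stens h1 h2 =>
      obtain ⟨c', x, rfl, hx, hd⟩ := SRep.ctx c h2
      exact ⟨.tensR _ c', x, rfl, hx, fun u u' hu => hd _ _ (.srsub hu h1)⟩
  | .rsubL c s, b, h => by
    cases h with
    | srsub h1 h2 =>
      obtain ⟨c', x, rfl, hx, hd⟩ := SRep.ctx c h1
      exact ⟨.rsubL c' _, x, rfl, hx, fun u u' hu => hd _ _ (.stens h2 hu)⟩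
  | .rsubR s c, b, h => by
    cases h with
    | srsub h1 h2 =>
      obtain ⟨c', x, rfl, hx, hd⟩ := SRep.ctx c h2
      exact ⟨.rsubR _ c', x, rfl, hx, fun u u' hu => hd _ _ (.slsub hu h1)⟩
  | .lsubL c s, b, h => by
    cases h with
    | slsub h1 h2 =>
      obtain ⟨c', x, rfl, hx, hd⟩ := SRep.ctx c h1
      exact ⟨.lsubL c' _, x, rfl, hx, fun u u' hu => hd _ _ (.srsub h2 hu)⟩
  | .lsubR s c, b, h => by
    cases h with
    | slsub h1 h2 =>
      obtain ⟨c', x, rfl, hx, hd⟩ := SRep.ctx c h2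
      exact ⟨.lsubR _ c', x, rfl, hx, fun u u' hu => hd _ _ (.stens hu h1)⟩

theorem dec_rep {X N p} (hp : ∀ s, Tstar N.dual s → FSeq X p s)
    (hcut : ∀ s, Tstar N.dual s → ∀ a t, FFoc X a s → FSeq X t s → FSeq X t a)
    {M s} (c : FCtx) {u b u'} (hM : Sum.inr M ∈ Xtau X) (hs : Tstar M.dual s)
    (hf : ∀ a, SRep N p (c.div u) a → FFoc X a s)
    (hb : SRep N p (c.fill (.nfm M)) b) (hu : SRep N p u u') : FSeq X b u' := by
  obtain ⟨c', x, rfl, hx, hd⟩ := SRep.ctx c hb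
  have hf' := hf _ (hd _ _ hu)
  cases hx with
  | rep => exact FSeq.undisplay c' _ (hcut s hs _ _ hf' (hp s hs))
  | nfm => exact .decL c' _ hM hs hf'

mutual
theorem FSeq.subst {X N p} (hp : ∀ s, Tstar N.dual s → FSeq X p s)
    (hcut : ∀ s, Tstar N.dual s → ∀ a t, FFoc X a s → FSeq X t s → FSeq X t a) :
    ∀ {a b}, FSeq X a b → ∀ a' b', SRep N p a a' → SRep N p b b' → FSeq X a' b'
  | _, _, .decL c _ hM hs hf => fun _ _ ha hb =>
    dec_rep hp hcut c hM hs (fun a h => hf.subst hp hcut a h) ha hb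
  | _, _, .decR c _ hM hs hf => fun _ _ hb ha =>
    (dec_rep hp hcut c hM hs (fun a h => hf.subst hp hcut a h) ha hb).sym
theorem FFoc.subst {X N p} (hp : ∀ s, Tstar N.dual s → FSeq X p s)
    (hcut : ∀ s, Tstar N.dual s → ∀ a t, FFoc X a s → FSeq X t s → FSeq X t a) :
    ∀ {a b}, FFoc X a b → ∀ a', SRep N p a a' → FFoc X a' b
  | _, _, .id => fun a' h => by cases h; exact .id
  | _, _, .react h => fun a' ha =>
    .react fun s hs => (h s hs).subst hp hcut _ _ ha (SRep.rfl' s)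
  | _, _, .tens h k => fun a' ha => by
    cases ha with
    | stens h1 h2 => exact .tens (h.subst hp hcut _ h1) (k.subst hp hcut _ h2)
  | _, _, .rsub h k => fun a' ha => by
    cases ha with
    | srsub h1 h2 => exact .rsub (h.subst hp hcut _ h2) (k.subst hp hcut _ h1)
  | _, _, .lsub h k => fun a' ha => by
    cases ha with
    | slsub h1 h2 => exact .lsub (h.subst hp hcut _ h1) (k.subst hp hcut _ h2)
end

def Good (X : Set NFm) (N : NFm) : Prop :=
  ∀ p t, (∀ s, Tstar N.dual s → FSeq X p s) → FSeq X t (.nfm N) → FSeq X t p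

theorem cutFoc {X} : ∀ (s : FStr), s.All (Good X) → ∀ a t, FFoc X a s → FSeq X t s → FSeq X t a
  | .at n, _, a, t, hf, h => by cases hf; exact h
  | .nfm N, hg, a, t, hf, h => by
    cases hf with
    | react hr => exact hg _ _ hr h
  | .stens x y, hg, a, t, hf, h => by
    cases hf with
    | tens h1 h2 =>
      exact (cutFoc x hg.1 _ _ h1 (cutFoc y hg.2 _ _ h2 h.dp2).dp2'.sym.dp1.sym).sym.dp1'.sym
  | .srsub x y, hg, a, t, hf, h => by
    cases hf with
    | rsub h2 h1 =>
      exact (cutFoc y hg.2 _ _ h2 (cutFoc x hg.1 _ _ h1 h.sym.dp2'.sym).dp1.sym).sym.dp1'.sym.dp2.sym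
  | .slsub x y, hg, a, t, hf, h => by
    cases hf with
    | lsub h1 h2 =>
      exact (cutFoc x hg.1 _ _ h1 (cutFoc y hg.2 _ _ h2 h.dp1').sym.dp2).dp2'.sym.dp1

theorem good_all {X} : ∀ (n : ℕ) (N : NFm), N.sz < n → Good X N
  | 0, _, h => absurd h (Nat.not_lt_zero _)
  | n + 1, N, h => fun p t hp ht => by
    refine ht.subst hp (fun s hs => cutFoc s ?_) _ _ (SRep.rfl' _) .rep
    refine hs.all_sz.mono fun M hM => good_all n M ?_
    rw [NFm.sz_dual] at hM; omega

theorem all_true {K : NFm → Prop} (h : ∀ N, K N) : ∀ s : FStr, s.All K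
  | .at _ => trivial
  | .nfm N => h N
  | .stens a b => ⟨all_true h a, all_true h b⟩
  | .srsub a b => ⟨all_true h a, all_true h b⟩
  | .slsub a b => ⟨all_true h a, all_true h b⟩

theorem cut_adm {X a s t} (h : FFoc X a s) (k : FSeq X t s) : FSeq X t a :=
  cutFoc s (all_true (fun N => good_all _ N (Nat.lt_succ_self _)) s) _ _ h k

theorem foc_id_of {X} : ∀ s : FStr, s.All (fun N => FFoc X (.nfm N) (.nfm N)) → FFoc X s s
  | .at _, _ => .id
  | .nfm _, h => h
  | .stens a b, h => .tens (foc_id_of a h.1) (foc_id_of b h.2)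
  | .srsub a b, h => .rsub (foc_id_of b h.2) (foc_id_of a h.1)
  | .slsub a b, h => .lsub (foc_id_of a h.1) (foc_id_of b h.2)

theorem foc_id_nfm : ∀ (n : ℕ) (N : NFm), N.sz < n → FFoc Set.univ (.nfm N) (.nfm N)
  | 0, _, h => absurd h (Nat.not_lt_zero _)
  | n + 1, N, h => .react fun s hs => by
    refine .decL .hole s (mem_univ_xtau N) hs (foc_id_of s ?_)
    refine hs.all_sz.mono fun M hM => foc_id_nfm n M ?_
    rw [NFm.sz_dual] at hM; omega

theorem foc_id (s : FStr) : FFoc Set.univ s s :=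
  foc_id_of s (all_true (fun N => foc_id_nfm _ N (Nat.lt_succ_self _)) s)

mutual
theorem PSeq.complete : ∀ {Γ Δ}, PSeq Γ Δ → ∀ p s, Tstar Γ.posF p → Tstar Δ.posF s →
    FSeq Set.univ p s
  | _, _, .cut h k => fun p s hp hs => by
    obtain ⟨s', hs', hf⟩ := h.complete s hs
    exact cut_adm hf (k.complete p s' hp hs')
  | _, _, .downL h => fun p s hp hs => by
    obtain ⟨s', hs', hf⟩ := h.complete p hp
    cases hs
    exact .decR .hole _ (mem_univ_xtau _) hs' hf
  | _, _, .tensL h => fun p s hp hs => h.complete p s hp hs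
  | _, _, .lsubL h => fun p s hp hs => h.complete p s hp (by
      simpa only [PStr.posF, PStr.negF, NFm.dd] using hs)
  | _, _, .rsubL h => fun p s hp hs => h.complete p s hp (by
      simpa only [PStr.posF, PStr.negF, NFm.dd] using hs)
  | _, _, .disjL h k => fun p s hp hs => by
    cases hs with
    | disjl hs => exact h.complete p s hp hs
    | disjr hs => exact k.complete p s hp hs
  | _, _, .sym h => fun p s hp hs => (h.complete s p hs hp).sym
  | _, _, .dp1 h => fun p s hp hs => by
    cases hs with
    | lsub h1 h2 =>
      rw [PStr.neg_dual] at h2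
      exact (h.complete _ _ (.tens hp h2) h1).dp1
  | _, _, .dp1' h => fun p s hp hs => by
    cases hp with
    | tens h1 h2 =>
      exact (h.complete _ _ h1 (.lsub hs (by rw [PStr.neg_dual]; exact h2))).dp1'
  | _, _, .dp2 h => fun p s hp hs => by
    cases hp with
    | rsub h1 h2 =>
      rw [PStr.neg_dual] at h2
      exact (h.complete _ _ h1 (.tens h2 hs)).dp2
  | _, _, .dp2' h => fun p s hp hs => by
    cases hs with
    | tens h1 h2 =>
      exact (h.complete _ _ (.rsub hp (by rw [PStr.neg_dual]; exact h1)) h2).dp2'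
theorem PStoup.complete : ∀ {Γ P}, PStoup Γ P → ∀ p, Tstar Γ.posF p →
    ∃ s, Tstar P s ∧ FFoc Set.univ p s
  | _, _, .id => fun p hp => ⟨p, hp, foc_id p⟩
  | _, _, .downR h => fun p hp => ⟨_, .down, .react fun s hs => h.complete p s hp hs⟩
  | _, _, .tensR h k => fun p hp => by
    cases hp with
    | tens h1 h2 =>
      obtain ⟨a, ha, hfa⟩ := h.complete _ h1
      obtain ⟨b, hb, hfb⟩ := k.complete _ h2
      exact ⟨_, .tens ha hb, .tens hfa hfb⟩
  | _, _, .lsubR h k => fun p hp => by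
    cases hp with
    | lsub h1 h2 =>
      rw [PStr.neg_dual] at h2
      obtain ⟨a, ha, hfa⟩ := h.complete _ h2
      obtain ⟨b, hb, hfb⟩ := k.complete _ h1
      exact ⟨_, .lsub hb ha, .lsub hfa hfb⟩
  | _, _, .rsubR h k => fun p hp => by
    cases hp with
    | rsub h1 h2 =>
      rw [PStr.neg_dual] at h2
      obtain ⟨a, ha, hfa⟩ := h.complete _ h2
      obtain ⟨b, hb, hfb⟩ := k.complete _ h1
      exact ⟨_, .rsub hb ha, .rsub hfa hfb⟩
  | _, _, .disjRl h => fun p hp =>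
    let ⟨s, hs, hf⟩ := h.complete p hp
    ⟨s, .disjl hs, hf⟩
  | _, _, .disjRr h => fun p hp =>
    let ⟨s, hs, hf⟩ := h.complete p hp
    ⟨s, .disjr hs, hf⟩
end

/-! Soundness -/
def FStr.emb : FStr → PStr
  | .at n => .fm (.pos n)
  | .nfm N => .fm (.down N)
  | .stens a b => .stens a.emb b.emb
  | .srsub a b => .srsub a.emb b.emb
  | .slsub a b => .slsub a.emb b.emb

theorem PSeq.undisplay {a : FStr} : ∀ (c : FCtx) (u : FStr),
    PSeq a.emb (c.div u).emb → PSeq (c.fill a).emb u.emb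
  | .hole, _, h => h
  | .tensL c _, _, h => (PSeq.undisplay c _ h).dp1'
  | .tensR _ c, _, h => (PSeq.undisplay c _ h).sym.dp2'.sym
  | .rsubL c _, _, h => (PSeq.undisplay c _ h).dp2
  | .rsubR _ c, _, h => (PSeq.undisplay c _ h).dp1'.sym.dp2
  | .lsubR _ c, _, h => (PSeq.undisplay c _ h).sym.dp1.sym
  | .lsubL c _, _, h => (PSeq.undisplay c _ h).sym.dp2'.sym.dp1.sym

theorem pinv : ∀ (n : ℕ) (P : PFm), P.sz < n → ∀ Θ, (∀ s, Tstar P s → PSeq Θ s.emb) →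
    PSeq Θ (.fm P)
  | 0, _, h, _, _ => absurd h (Nat.not_lt_zero _)
  | n + 1, .pos m, _, Θ, H => H _ .at
  | n + 1, .down N, _, Θ, H => H _ .down
  | n + 1, .disj P Q, h, Θ, H => by
    simp only [PFm.sz] at h
    exact .disjL (pinv n P (by omega) Θ fun s hs => H s (.disjl hs))
      (pinv n Q (by omega) Θ fun s hs => H s (.disjr hs))
  | n + 1, .tens P Q, h, Θ, H => by
    simp only [PFm.sz] at h
    refine .tensL (PSeq.sym (PSeq.dp1' (PSeq.sym (pinv n P (by omega) _ fun s hs => ?_))))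
    refine PSeq.sym (PSeq.dp1 (PSeq.sym (PSeq.dp2' (pinv n Q (by omega) _ fun t ht => ?_))))
    exact (H _ (.tens hs ht)).dp2
  | n + 1, .rsub P N, h, Θ, H => by
    simp only [PFm.sz] at h
    have e := NFm.sz_dual N
    refine .rsubL (PSeq.sym (PSeq.dp2 (PSeq.sym (pinv n P (by omega) _ fun s hs => ?_))))
    refine PSeq.dp1' (PSeq.sym (pinv n N.dual (by omega) _ fun t ht => ?_))
    exact (H _ (.rsub hs ht)).sym.dp2'.sym.dp1.sym
  | n + 1, .lsub N P, h, Θ, H => by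
    simp only [PFm.sz] at h
    have e := NFm.sz_dual N
    refine .lsubL (PSeq.dp1 (pinv n P (by omega) _ fun s hs => ?_))
    refine PSeq.sym (PSeq.dp2' (pinv n N.dual (by omega) _ fun t ht => ?_))
    exact (H _ (.lsub hs ht)).dp1'.sym.dp2

theorem pinv' {P Θ} (H : ∀ s, Tstar P s → PSeq Θ s.emb) : PSeq Θ (.fm P) :=
  pinv _ P (Nat.lt_succ_self _) Θ H

theorem tstar_elim {P s Γ} (h : Tstar P s)
    (H : (∀ Q, Tstar Q s → (∀ A B, Q ≠ .disj A B) → PStoup Γ Q)) : PStoup Γ P := by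
  induction h with
  | tens h k => exact H _ (.tens h k) (by simp)
  | rsub h k => exact H _ (.rsub h k) (by simp)
  | lsub h k => exact H _ (.lsub h k) (by simp)
  | disjl _ ih => exact .disjRl (ih H)
  | disjr _ ih => exact .disjRr (ih H)
  | down => exact H _ .down (by simp)
  | _ => exact H _ .at (by simp)

mutual
theorem FSeq.sound {X} : ∀ {a b}, FSeq X a b → PSeq a.emb b.emb
  | _, _, .decL c _ _ hs hf => PSeq.undisplay c _ (PSeq.sym (PSeq.downL (hf.sound _ hs)))
  | _, _, .decR c _ _ hs hf => (PSeq.undisplay c _ (PSeq.sym (PSeq.downL (hf.sound _ hs)))).sym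
theorem FFoc.sound {X} : ∀ {a s}, FFoc X a s → ∀ P, Tstar P s → PStoup a.emb P
  | _, _, .id => fun P hP => tstar_elim hP fun Q hQ hn => by
    cases hQ with
    | disjl => exact absurd rfl (hn _ _)
    | disjr => exact absurd rfl (hn _ _)
    | _ => exact .id
  | _, _, .react h => fun P hP => tstar_elim hP fun Q hQ hn => by
    cases hQ with
    | disjl => exact absurd rfl (hn _ _)
    | disjr => exact absurd rfl (hn _ _)
    | down => exact .downR (pinv' fun s hs => (h s hs).sound)
  | _, _, .tens h k => fun P hP => tstar_elim hP fun Q hQ hn => by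
    cases hQ with
    | disjl => exact absurd rfl (hn _ _)
    | disjr => exact absurd rfl (hn _ _)
    | tens h1 h2 => exact .tensR (h.sound _ h1) (k.sound _ h2)
  | _, _, .rsub h k => fun P hP => tstar_elim hP fun Q hQ hn => by
    cases hQ with
    | disjl => exact absurd rfl (hn _ _)
    | disjr => exact absurd rfl (hn _ _)
    | rsub h1 h2 => exact .rsubR (h.sound _ h2) (k.sound _ h1)
  | _, _, .lsub h k => fun P hP => tstar_elim hP fun Q hQ hn => by
    cases hQ with
    | disjl => exact absurd rfl (hn _ _)
    | disjr => exact absurd rfl (hn _ _)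
    | lsub h1 h2 => exact .lsubR (h.sound _ h2) (k.sound _ h1)
end

theorem stoup_posF : ∀ Γ : PStr, PStoup Γ Γ.posF
  | .fm _ => .id
  | .stens a b => .tensR (stoup_posF a) (stoup_posF b)
  | .srsub a b => .rsubR (by rw [PStr.neg_dual]; exact stoup_posF b) (stoup_posF a)
  | .slsub a b => .lsubR (by rw [PStr.neg_dual]; exact stoup_posF a) (stoup_posF b)

/-- Corollary 4.15, focalization: the presentation `Γ,Δ ⊢` is derivable
in LG∅^pol iff the focused presentation `π,σ ⊢` is derivable for every π ∈ τ*(Γ⁺) and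
σ ∈ τ*(Δ⁺), with the parameter set X instantiated to {Γ⁻, Δ⁻}. -/
theorem focalization (Γ Δ : PStr) :
    PSeq Γ Δ ↔
    (∀ π σ : FStr, Tstar Γ.posF π → Tstar Δ.posF σ → FSeq {Γ.negF, Δ.negF} π σ) := by
  constructor
  · intro h p s hp hs
    have e1 := hp
    have e2 := hs
    rw [← PStr.neg_dual] at e1 e2
    exact (h.complete p s hp hs).restrict
      (xtau_closed (mem_xtau (Set.mem_insert _ _)) e1)
      (xtau_closed (mem_xtau (Set.mem_insert_of_mem _ (Set.mem_singleton _))) e2)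
  · intro H
    refine .cut (stoup_posF Δ) (pinv' fun s hs => ?_)
    refine PSeq.sym (.cut (stoup_posF Γ) (pinv' fun p hp => ?_))
    exact (H p s hp hs).sound.sym
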